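/- arXiv:math/0504044 — 2 statements merged into one kernel-verified Lean document; each statement's English description precedes it below -/
import Mathlib

section
/- Let ε ∈ (0, 1/3) and R₀ > 0. Then there exists N ∈ ℕ such that for every n ≥ N, every monic polynomial p of degree n over ℂ all of whose roots lie in the closed disk {w : |w| ≤ R₀}, and every entire function g : ℂ → ℂ with ∫_ℂ |p(z)g(z)|² e^{-|z|²} dm(z) < ∞, one has sup_{|z| ≤ R₀} |g(z)|² ≤ (1−ε)^{-2n} · (1/n!) · ∫_ℂ |p(z)g(z)|² e^{-|z|²} dm(z). -/
open MeasureTheory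

/-- A submean value inequality for `‖g‖ ^ 2` at an arbitrary point of a disk centred at `0`. -/
lemma norm_sq_le_integral_circleMap {g : ℂ → ℂ} (hg : Differentiable ℂ g) {z : ℂ} {r : ℝ}
    (hz : ‖z‖ < r) :
    (r - ‖z‖) * (2 * Real.pi * ‖g z‖ ^ 2) ≤
      r * ∫ θ in -Real.pi..Real.pi, ‖g (circleMap 0 r θ)‖ ^ 2 := by
  have hr : 0 < r := (norm_nonneg z).trans_lt hz
  have hd : 0 < r - ‖z‖ := sub_pos.2 hz
  have hcauchy := DiffContOnCl.circleAverage_smul_div (f := fun w => g w ^ 2) (c := 0) (R := r)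
    (w := z) (hg.pow 2).diffContOnCl (by simpa [abs_of_pos hr] using hz)
  rw [Real.circleAverage_eq_integral_add (-Real.pi),
    intervalIntegral.integral_comp_add_right
      (fun θ => ((circleMap 0 r θ - 0) / (circleMap 0 r θ - z)) • g (circleMap 0 r θ) ^ 2)]
    at hcauchy
  have hends : 2 * Real.pi + -Real.pi = Real.pi := by ring
  rw [zero_add, hends] at hcauchy
  have hpi : (0 : ℝ) < 2 * Real.pi := by positivity
  have hnorm : 2 * Real.pi * ‖g z‖ ^ 2 =
      ‖∫ θ in -Real.pi..Real.pi,
        ((circleMap 0 r θ - 0) / (circleMap 0 r θ - z)) • g (circleMap 0 r θ) ^ 2‖ := by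
    rw [← norm_pow, ← hcauchy, norm_smul, Real.norm_of_nonneg (by positivity),
      mul_inv_cancel_left₀ hpi.ne']
  have hbound : 2 * Real.pi * ‖g z‖ ^ 2 ≤
      ∫ θ in -Real.pi..Real.pi, r / (r - ‖z‖) * ‖g (circleMap 0 r θ)‖ ^ 2 := by
    rw [hnorm]
    refine intervalIntegral.norm_integral_le_of_norm_le (by linarith) ?_ ?_
    · refine .of_forall fun θ _ => ?_
      rw [norm_smul, norm_pow, norm_div, sub_zero, norm_circleMap_zero, abs_of_pos hr]
      have hsub : r - ‖z‖ ≤ ‖circleMap 0 r θ - z‖ := by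
        simpa [abs_of_pos hr] using norm_sub_norm_le (circleMap 0 r θ) z
      gcongr
    · have := hg.continuous
      exact Continuous.intervalIntegrable (by fun_prop) _ _
  rw [intervalIntegral.integral_const_mul, div_mul_eq_mul_div, le_div_iff₀ hd] at hbound
  linarith

/-- Integrating lower bounds for the circle integrals of a nonnegative function bounds its integral
over the plane from below. -/
lemma integral_Ioi_mul_le_integral {F : ℂ → ℝ} (hF : Continuous F) (hF₀ : ∀ w, 0 ≤ F w)
    (hFi : Integrable F) {A : ℝ} (hA : 0 ≤ A) {φ : ℝ → ℝ} (hφ₀ : ∀ r > A, 0 ≤ φ r)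
    (hφi : IntegrableOn (fun r => r * φ r) (Set.Ioi A))
    (hφ : ∀ r > A, φ r ≤ ∫ θ in -Real.pi..Real.pi, F (circleMap 0 r θ)) :
    ∫ r in Set.Ioi A, r * φ r ≤ ∫ w, F w := by
  have hmeas : Measurable fun p : ℝ × ℝ =>
      ENNReal.ofReal p.1 * ENNReal.ofReal (F (circleMap 0 p.1 p.2)) := by
    unfold circleMap
    exact (measurable_fst.ennreal_ofReal).mul
      (Continuous.measurable (by fun_prop)).ennreal_ofReal
  rw [← ENNReal.ofReal_le_ofReal_iff (integral_nonneg hF₀),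
    ofReal_integral_eq_lintegral_ofReal hFi (.of_forall hF₀),
    ofReal_integral_eq_lintegral_ofReal hφi
      ((ae_restrict_iff' measurableSet_Ioi).2 <| .of_forall fun r hr =>
        mul_nonneg (hA.trans hr.le) (hφ₀ r hr)),
    ← Complex.lintegral_comp_polarCoord_symm]
  calc ∫⁻ r in Set.Ioi A, ENNReal.ofReal (r * φ r)
      ≤ ∫⁻ r in Set.Ioi A, ∫⁻ θ in Set.Ioo (-Real.pi) Real.pi,
          ENNReal.ofReal r * ENNReal.ofReal (F (circleMap 0 r θ)) := by
        refine setLIntegral_mono' measurableSet_Ioi fun r hr => ?_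
        have hr₀ : 0 ≤ r := hA.trans (le_of_lt hr)
        have hcont : Continuous fun θ => F (circleMap 0 r θ) := by fun_prop
        rw [ENNReal.ofReal_mul hr₀, lintegral_const_mul _ hcont.measurable.ennreal_ofReal]
        gcongr
        rw [← ofReal_integral_eq_lintegral_ofReal
          ((hcont.integrableOn_Icc).mono_set Set.Ioo_subset_Icc_self) (.of_forall fun _ => hF₀ _)]
        refine ENNReal.ofReal_le_ofReal ((hφ r hr).trans_eq ?_)
        rw [intervalIntegral.integral_of_le (by linarith [Real.pi_pos]),
          integral_Ioc_eq_integral_Ioo]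
    _ = ∫⁻ p in Set.Ioi A ×ˢ Set.Ioo (-Real.pi) Real.pi,
          ENNReal.ofReal p.1 * ENNReal.ofReal (F (circleMap 0 p.1 p.2)) := by
        rw [Measure.volume_eq_prod, ← Measure.prod_restrict, lintegral_prod _ hmeas.aemeasurable]
    _ ≤ ∫⁻ p in polarCoord.target,
          ENNReal.ofReal p.1 * ENNReal.ofReal (F (circleMap 0 p.1 p.2)) :=
        lintegral_mono_set (Set.prod_mono (Set.Ioi_subset_Ioi hA) subset_rfl)
    _ = _ := by
        simp only [Complex.polarCoord_symm_apply, smul_eq_mul, circleMap_zero, Complex.exp_mul_I,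
          Complex.ofReal_cos, Complex.ofReal_sin]

lemma integrableOn_pow_mul_exp_neg_sq (m : ℕ) :
    IntegrableOn (fun r : ℝ => r ^ m * Real.exp (-r ^ 2)) (Set.Ioi 0) := by
  simpa only [Real.rpow_natCast, Real.rpow_two] using
    integrableOn_rpow_mul_exp_neg_rpow (p := 2) (s := m)
      (neg_one_lt_zero.trans_le m.cast_nonneg) two_pos

lemma integral_Ioi_pow_mul_exp_neg_sq (n : ℕ) :
    ∫ r in Set.Ioi (0 : ℝ), r ^ (2 * n + 1) * Real.exp (-r ^ 2) = n.factorial / 2 := by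
  have h := integral_rpow_mul_exp_neg_rpow (p := 2) (q := (2 * n + 1 : ℕ)) two_pos
    (neg_one_lt_zero.trans_le (Nat.cast_nonneg _))
  have hΓ : (((2 * n + 1 : ℕ) : ℝ) + 1) / 2 = n + 1 := by push_cast; ring
  rw [hΓ, Real.Gamma_nat_eq_factorial] at h
  simp only [Real.rpow_natCast, Real.rpow_two] at h
  rw [h]
  ring

lemma factorial_half_sub_le_integral_Ioi {A : ℝ} (hA : 0 ≤ A) (n : ℕ) :
    n.factorial / 2 - A ^ (2 * n + 2) ≤
      ∫ r in Set.Ioi A, r ^ (2 * n + 1) * Real.exp (-r ^ 2) := by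
  have hint := integrableOn_pow_mul_exp_neg_sq (2 * n + 1)
  have hsplit := intervalIntegral.integral_Ioi_sub_Ioi hint hA
  have hle : ∫ r in (0 : ℝ)..A, r ^ (2 * n + 1) * Real.exp (-r ^ 2) ≤
      ∫ _ in (0 : ℝ)..A, A ^ (2 * n + 1) := by
    refine intervalIntegral.integral_mono_on hA
      (Continuous.intervalIntegrable (by fun_prop) _ _) (by simp) fun r hr => ?_
    have hexp : Real.exp (-r ^ 2) ≤ 1 := Real.exp_le_one_iff.2 (by nlinarith)
    calc r ^ (2 * n + 1) * Real.exp (-r ^ 2) ≤ A ^ (2 * n + 1) * 1 := by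
          have := hr.1
          have := hr.2
          gcongr
      _ = A ^ (2 * n + 1) := mul_one _
  rw [intervalIntegral.integral_const, smul_eq_mul, sub_zero] at hle
  rw [integral_Ioi_pow_mul_exp_neg_sq] at hsplit
  have hpow : A ^ (2 * n + 2) = A * A ^ (2 * n + 1) := by ring
  linarith

lemma pow_natDegree_le_norm_eval {p : Polynomial ℂ} (hp : p.Monic) {R : ℝ}
    (hroots : ∀ a ∈ p.roots, ‖a‖ ≤ R) {w : ℂ} (hw : R ≤ ‖w‖) :
    (‖w‖ - R) ^ p.natDegree ≤ ‖p.eval w‖ := by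
  have hsplits := IsAlgClosed.splits p
  have heval : ‖p.eval w‖ = (p.roots.map fun a => ‖w - a‖).prod := by
    conv_lhs => rw [hsplits.eq_prod_roots_of_monic hp]
    rw [Polynomial.eval_multiset_prod, ← normHom_apply, map_multiset_prod]
    simp [Multiset.map_map]
  rw [heval, hsplits.natDegree_eq_card_roots, ← Multiset.prod_replicate,
    ← Multiset.map_const']
  refine Multiset.prod_map_le_prod_map₀ _ _ (fun _ _ => sub_nonneg.2 hw) fun a ha => ?_
  linarith [norm_sub_norm_le w a, hroots a ha]

theorem fock_space_sup_bound (ε R₀ : ℝ) (hε : ε ∈ Set.Ioo (0:ℝ) (1/3)) (hR₀ : 0 < R₀) :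
    ∃ N : ℕ, ∀ n ≥ N, ∀ p : Polynomial ℂ, p.Monic → p.natDegree = n →
      (∀ w ∈ p.roots, ‖w‖ ≤ R₀) →
      ∀ g : ℂ → ℂ, Differentiable ℂ g →
        Integrable (fun z : ℂ =>
          ‖p.eval z * g z‖ ^ 2 * Real.exp (-‖z‖ ^ 2)) →
        ∀ z : ℂ, ‖z‖ ≤ R₀ →
          ‖g z‖ ^ 2 ≤
            ((1 - ε) ^ (2 * n))⁻¹ * ((Nat.factorial n : ℝ))⁻¹ *
              ∫ w : ℂ, ‖p.eval w * g w‖ ^ 2 * Real.exp (-‖w‖ ^ 2) := by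
  obtain ⟨hε₀, hε₁⟩ := hε
  have hδ : 0 < 1 - ε := by linarith
  set A := R₀ / ε
  have hA₀ : 0 < A := by positivity
  obtain ⟨N, hN⟩ := Filter.eventually_atTop.1
    ((FloorSemiring.tendsto_pow_div_factorial_atTop (A ^ 2)).eventually_le_const
      (u := 1 / (4 * A ^ 2)) (by positivity))
  refine ⟨N, fun n hn p hp hdeg hroots g hg hint z hz => ?_⟩
  have hfac : (0 : ℝ) < n.factorial := by positivity
  have hsmall : A ^ (2 * n + 2) ≤ n.factorial / 4 := by
    have h := hN n hn
    rw [div_le_div_iff₀ hfac (by positivity)] at h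
    have hpow : A ^ (2 * n + 2) = (A ^ 2) ^ n * A ^ 2 := by ring
    linarith
  set c := 2 * Real.pi * ‖g z‖ ^ 2 * (1 - ε) ^ (2 * n + 1) with hc
  have hc₀ : 0 ≤ c := by positivity
  have hcircle : ∀ r > A, c * (r ^ (2 * n) * Real.exp (-r ^ 2)) ≤
      ∫ θ in -Real.pi..Real.pi, ‖p.eval (circleMap 0 r θ) * g (circleMap 0 r θ)‖ ^ 2 *
        Real.exp (-‖circleMap 0 r θ‖ ^ 2) := by
    intro r hr
    have hr₀ : 0 < r := hA₀.trans hr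
    have hRr : (1 - ε) * r ≤ r - R₀ := by
      have : R₀ < r * ε := (div_lt_iff₀ hε₀).1 hr
      linarith
    have hR₀r : R₀ < r := by nlinarith
    have hmean := norm_sq_le_integral_circleMap hg (hz.trans_lt hR₀r)
    have hmean' : (1 - ε) * (2 * Real.pi * ‖g z‖ ^ 2) ≤
        ∫ θ in -Real.pi..Real.pi, ‖g (circleMap 0 r θ)‖ ^ 2 := by
      refine le_of_mul_le_mul_left (le_trans ?_ hmean) hr₀
      rw [← mul_assoc, mul_comm r]
      gcongr
      linarith
    have hgc := hg.continuous
    calc c * (r ^ (2 * n) * Real.exp (-r ^ 2))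
        = ((1 - ε) * r) ^ (2 * n) * Real.exp (-r ^ 2) *
            ((1 - ε) * (2 * Real.pi * ‖g z‖ ^ 2)) := by rw [hc, mul_pow]; ring
      _ ≤ ((1 - ε) * r) ^ (2 * n) * Real.exp (-r ^ 2) *
            ∫ θ in -Real.pi..Real.pi, ‖g (circleMap 0 r θ)‖ ^ 2 := by gcongr
      _ = ∫ θ in -Real.pi..Real.pi, ((1 - ε) * r) ^ (2 * n) * Real.exp (-r ^ 2) *
            ‖g (circleMap 0 r θ)‖ ^ 2 := by rw [intervalIntegral.integral_const_mul]
      _ ≤ _ := by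
        refine intervalIntegral.integral_mono_on (by linarith [Real.pi_pos])
          (Continuous.intervalIntegrable (by fun_prop) _ _)
          (Continuous.intervalIntegrable (by fun_prop) _ _) fun θ _ => ?_
        have hw : ‖circleMap 0 r θ‖ = r := by rw [norm_circleMap_zero, abs_of_pos hr₀]
        have hp_le : ((1 - ε) * r) ^ n ≤ ‖p.eval (circleMap 0 r θ)‖ := by
          have h := pow_natDegree_le_norm_eval hp hroots (hR₀r.le.trans_eq hw.symm)
          rw [hdeg, hw] at h
          exact (pow_le_pow_left₀ (by positivity) hRr n).trans h
        rw [hw, norm_mul, mul_pow ‖p.eval _‖, mul_comm 2 n, pow_mul, mul_right_comm]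
        gcongr
  have hφeq : ∀ r : ℝ, r * (c * (r ^ (2 * n) * Real.exp (-r ^ 2))) =
      c * (r ^ (2 * n + 1) * Real.exp (-r ^ 2)) := fun r => by ring
  have hgc := hg.continuous
  have hplane := integral_Ioi_mul_le_integral (by fun_prop) (fun w => by positivity) hint hA₀.le
    (fun r hr => by have := hA₀.trans hr; positivity)
    (by
      simp only [hφeq]
      exact ((integrableOn_pow_mul_exp_neg_sq (2 * n + 1)).mono_set
        (Set.Ioi_subset_Ioi hA₀.le)).const_mul c)
    hcircle
  simp only [hφeq, integral_const_mul] at hplane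
  have hgamma := factorial_half_sub_le_integral_Ioi hA₀.le n
  rw [← mul_inv, ← div_eq_inv_mul, le_div_iff₀ (by positivity)]
  calc ‖g z‖ ^ 2 * ((1 - ε) ^ (2 * n) * n.factorial)
      = 1 * (‖g z‖ ^ 2 * ((1 - ε) ^ (2 * n) * n.factorial)) := (one_mul _).symm
    _ ≤ Real.pi / 2 * (1 - ε) * (‖g z‖ ^ 2 * ((1 - ε) ^ (2 * n) * n.factorial)) := by
        gcongr
        nlinarith [Real.pi_gt_three]
    _ = c * (n.factorial / 4) := by rw [hc]; ring
    _ ≤ c * ∫ r in Set.Ioi A, r ^ (2 * n + 1) * Real.exp (-r ^ 2) := by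
        gcongr
        linarith
    _ ≤ _ := hplane
end

section
/- Let R₀ > 0, ε ∈ (0,1), and let q be a monic polynomial of degree m over ℂ all of whose roots lie in the closed disk {w : |w| ≤ R₀}. Then ∫_{|z| ≥ R₀/ε} |q(z)|² e^{-|z|²} dm(z) ≤ (1+ε)^{2m} · π · m!. -/
open MeasureTheory

theorem integral_norm_pow_mul_exp_neg_sq (m : ℕ) :
    ∫ z : ℂ, ‖z‖ ^ (2 * m) * Real.exp (-‖z‖ ^ 2) = Real.pi * (Nat.factorial m : ℝ) := by
  have hq : (-2 : ℝ) < ((2 * m : ℕ) : ℝ) := by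
    linarith [Nat.cast_nonneg (α := ℝ) (2 * m)]
  have h := Complex.integral_rpow_mul_exp_neg_rpow one_le_two hq
  have harg : (((2 * m : ℕ) : ℝ) + 2) / 2 = m + 1 := by push_cast; ring
  rw [harg, Real.Gamma_nat_eq_factorial, mul_div_cancel_left₀ _ two_ne_zero] at h
  simpa only [Real.rpow_natCast, Real.rpow_two] using h

theorem integrable_norm_pow_mul_exp_neg_sq (m : ℕ) :
    Integrable fun z : ℂ ↦ ‖z‖ ^ (2 * m) * Real.exp (-‖z‖ ^ 2) := by
  apply Integrable.of_integral_ne_zero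
  rw [integral_norm_pow_mul_exp_neg_sq]
  positivity

theorem Polynomial.Monic.norm_eval_le_pow_natDegree {q : Polynomial ℂ} (hq : q.Monic) {R : ℝ}
    (hroots : ∀ w ∈ q.roots, ‖w‖ ≤ R) (z : ℂ) :
    ‖q.eval z‖ ≤ (‖z‖ + R) ^ q.natDegree := by
  have hs := IsAlgClosed.splits q
  rw [hs.eval_eq_prod_roots_of_monic hq, hs.natDegree_eq_card_roots]
  generalize q.roots = s at hroots
  induction s using Multiset.induction_on with
  | empty => simp
  | cons a s ih =>
    have ha := hroots a (Multiset.mem_cons_self a s)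
    have hz : ‖z - a‖ ≤ ‖z‖ + R := (norm_sub_le z a).trans (by gcongr)
    rw [Multiset.map_cons, Multiset.prod_cons, norm_mul, Multiset.card_cons, pow_succ']
    exact mul_le_mul hz (ih fun w hw ↦ hroots w (Multiset.mem_cons_of_mem hw))
      (norm_nonneg _) ((norm_nonneg _).trans hz)

theorem monic_poly_gaussian_integral_bound (R₀ ε : ℝ) (hR₀ : 0 < R₀)
    (hε : ε ∈ Set.Ioo (0:ℝ) 1) (m : ℕ) (q : Polynomial ℂ)
    (hmonic : q.Monic) (hdeg : q.natDegree = m)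
    (hroots : ∀ w ∈ q.roots, ‖w‖ ≤ R₀) :
    (∫ z in {z : ℂ | R₀ / ε ≤ ‖z‖},
        ‖q.eval z‖ ^ 2 * Real.exp (-‖z‖ ^ 2))
      ≤ (1 + ε) ^ (2 * m) * Real.pi * (Nat.factorial m : ℝ) := by
  have hε₀ : 0 < ε := hε.1
  have hmeas : MeasurableSet {z : ℂ | R₀ / ε ≤ ‖z‖} :=
    measurableSet_le measurable_const measurable_norm
  have hint := (integrable_norm_pow_mul_exp_neg_sq m).const_mul ((1 + ε) ^ (2 * m))
  calc
    _ ≤ ∫ z in {z : ℂ | R₀ / ε ≤ ‖z‖},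
        (1 + ε) ^ (2 * m) * (‖z‖ ^ (2 * m) * Real.exp (-‖z‖ ^ 2)) := by
      refine integral_mono_of_nonneg (.of_forall fun z ↦ by positivity) hint.integrableOn ?_
      filter_upwards [ae_restrict_mem hmeas] with z (hz : R₀ / ε ≤ ‖z‖)
      have hR : R₀ ≤ ‖z‖ * ε := (div_le_iff₀ hε₀).1 hz
      have hq : ‖q.eval z‖ ≤ ((1 + ε) * ‖z‖) ^ m := by
        rw [← hdeg]
        refine (hmonic.norm_eval_le_pow_natDegree hroots z).trans ?_
        gcongr
        linarith
      calc
        _ ≤ (((1 + ε) * ‖z‖) ^ m) ^ 2 * Real.exp (-‖z‖ ^ 2) := by gcongr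
        _ = _ := by rw [← pow_mul, mul_comm m 2, mul_pow, mul_assoc]
    _ ≤ ∫ z : ℂ, (1 + ε) ^ (2 * m) * (‖z‖ ^ (2 * m) * Real.exp (-‖z‖ ^ 2)) :=
      setIntegral_le_integral hint (.of_forall fun z ↦ by positivity)
    _ = _ := by rw [integral_const_mul, integral_norm_pow_mul_exp_neg_sq, mul_assoc]
end
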